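/- arXiv:2505.18447 — 2 statements merged into one kernel-verified Lean document; each statement's English description precedes it below -/
import Mathlib

section
/- Suppose P_0 is a transition kernel with (P_0)_s^a ∈ (𝒫_k)_s^a for every k ∈ {1,…,K} and every (s,a). Then for every policy π, every k, and every state s: V_{𝒫_k}^π(s) ≤ V_MP^π(s) ≤ V_{P_0}^π(s), where V_MP^π(s) = Σ_a π(a|s) Q_MP^π(s,a) and Q_MP^π is the unique fixed point of T_MP^π. -/
noncomputable section

/-- The probability simplex on a finite set `S`. -/
def simplex (S : Type*) [Fintype S] : Set (S → ℝ) :=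
  {p | (∀ s, 0 ≤ p s) ∧ ∑ s, p s = 1}

/-- Support function of a set of distributions: `σ_C(v) = inf_{p ∈ C} ∑_s p s * v s`. -/
def suppFn {S : Type*} [Fintype S] (C : Set (S → ℝ)) (v : S → ℝ) : ℝ :=
  sInf ((fun p => ∑ s, p s * v s) '' C)

/-- Robust Bellman operator of a policy `π`:
`(T_𝒫^π Q)(s,a) = r(s,a) + γ σ_{𝒫_s^a}(V_Q^π)` with `V_Q^π(s) = ∑_a π(a|s) Q(s,a)`. -/
def robustOp {S A : Type*} [Fintype S] [Fintype A] (r : S × A → ℝ) (γ : ℝ)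
    (P : S → A → Set (S → ℝ)) (π : S → A → ℝ) (Q : S × A → ℝ) : S × A → ℝ :=
  fun sa => r sa + γ * suppFn (P sa.1 sa.2) (fun s' => ∑ a', π s' a' * Q (s', a'))

/-- Optimal robust Bellman operator:
`(T_𝒫 Q)(s,a) = r(s,a) + γ σ_{𝒫_s^a}(s' ↦ max_{a'} Q(s',a'))`. -/
def optRobustOp {S A : Type*} [Fintype S] [Fintype A] [Nonempty A] (r : S × A → ℝ) (γ : ℝ)
    (P : S → A → Set (S → ℝ)) (Q : S × A → ℝ) : S × A → ℝ :=
  fun sa => r sa + γ * suppFn (P sa.1 sa.2)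
    (fun s' => Finset.univ.sup' Finset.univ_nonempty (fun a' => Q (s', a')))

theorem le_of_forall_le_add_imp_le_add_mul {X : Type*} [Finite X] [Nonempty X] {γ : ℝ}
    (hγ1 : γ < 1) {f g : X → ℝ}
    (h : ∀ M, (∀ x, f x ≤ g x + M) → ∀ x, f x ≤ g x + γ * M) (x : X) : f x ≤ g x := by
  obtain ⟨y, hy⟩ := Finite.exists_max fun x => f x - g x
  have hM := h (f y - g y) (fun x => by linarith [hy x]) y
  have hy0 : f y - g y ≤ 0 := by nlinarith
  linarith [hy x]

theorem weighted_sum_le_add_of_mem_simplex {S : Type*} [Fintype S] {p v w : S → ℝ} {M : ℝ}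
    (hp : p ∈ simplex S) (h : ∀ s, v s ≤ w s + M) :
    ∑ s, p s * v s ≤ ∑ s, p s * w s + M := by
  calc ∑ s, p s * v s ≤ ∑ s, p s * (w s + M) :=
        Finset.sum_le_sum fun s _ => mul_le_mul_of_nonneg_left (h s) (hp.1 s)
    _ = ∑ s, p s * w s + M := by
        simp only [mul_add, Finset.sum_add_distrib, ← Finset.sum_mul, hp.2, one_mul]

theorem bddBelow_image_of_subset_simplex {S : Type*} [Fintype S] {C : Set (S → ℝ)}
    (hC : C ⊆ simplex S) (v : S → ℝ) : BddBelow ((fun p => ∑ s, p s * v s) '' C) := by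
  obtain ⟨m, hm⟩ := (Set.finite_range v).bddBelow
  refine ⟨m, ?_⟩
  rintro _ ⟨p, hp, rfl⟩
  have h := weighted_sum_le_add_of_mem_simplex (v := fun _ => 0) (w := v) (M := -m) (hC hp)
    fun s => by linarith [hm ⟨s, rfl⟩]
  simp only [mul_zero, Finset.sum_const_zero] at h
  linarith

theorem suppFn_le_suppFn_add {S : Type*} [Fintype S] {C D : Set (S → ℝ)} (hC : C.Nonempty)
    (hCD : C ⊆ D) (hD : D ⊆ simplex S) {v w : S → ℝ} {M : ℝ} (h : ∀ s, v s ≤ w s + M) :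
    suppFn D v ≤ suppFn C w + M := by
  rw [← sub_le_iff_le_add]
  refine le_csInf (hC.image _) ?_
  rintro _ ⟨p, hp, rfl⟩
  rw [sub_le_iff_le_add]
  exact (csInf_le (bddBelow_image_of_subset_simplex hD v) ⟨p, hCD hp, rfl⟩).trans
    (weighted_sum_le_add_of_mem_simplex (hD (hCD hp)) h)

theorem robustOp_le_robustOp_add {S A : Type*} [Fintype S] [Fintype A] {r : S × A → ℝ} {γ : ℝ}
    (hγ0 : 0 ≤ γ) {P P' : S → A → Set (S → ℝ)} (hne : ∀ s a, (P' s a).Nonempty)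
    (hsub : ∀ s a, P' s a ⊆ P s a) (hP : ∀ s a, P s a ⊆ simplex S) {π : S → A → ℝ}
    (hπ : ∀ s, π s ∈ simplex A) {Q Q' : S × A → ℝ} {M : ℝ} (h : ∀ x, Q x ≤ Q' x + M)
    (x : S × A) : robustOp r γ P π Q x ≤ robustOp r γ P' π Q' x + γ * M := by
  have hs := suppFn_le_suppFn_add (hne x.1 x.2) (hsub x.1 x.2) (hP x.1 x.2)
    fun s => weighted_sum_le_add_of_mem_simplex (hπ s) fun a => h (s, a)
  unfold robustOp
  linarith [mul_le_mul_of_nonneg_left hs hγ0]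

/-- **Pessimism and dominance of the minimal-pessimism proxy.**  If the target
kernel `P0` belongs to every source uncertainty set, then for every policy
`V_{𝒫_k}^π ≤ V_MP^π ≤ V_{P0}^π`. -/
theorem minimal_pessimism_sandwich {S A : Type*} [Fintype S] [Fintype A]
    [Nonempty S] [Nonempty A]
    (r : S × A → ℝ) (hr : ∀ sa, 0 ≤ r sa ∧ r sa ≤ 1)
    (γ : ℝ) (hγ0 : 0 ≤ γ) (hγ1 : γ < 1)
    (K : ℕ) [NeZero K]
    (P : Fin K → S → A → Set (S → ℝ))
    (hP : ∀ k s a, (P k s a).Nonempty ∧ IsCompact (P k s a) ∧ P k s a ⊆ simplex S)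
    (P0 : S → A → (S → ℝ)) (hP0 : ∀ k s a, P0 s a ∈ P k s a)
    (π : S → A → ℝ) (hπ : ∀ s, π s ∈ simplex A)
    (Qk : Fin K → (S × A → ℝ)) (hQk : ∀ k, robustOp r γ (P k) π (Qk k) = Qk k)
    (QMP : S × A → ℝ)
    (hQMP : (fun sa => Finset.univ.sup' Finset.univ_nonempty
      (fun k => robustOp r γ (P k) π QMP sa)) = QMP)
    (QP0 : S × A → ℝ)
    (hQP0 : robustOp r γ (fun s a => {P0 s a}) π QP0 = QP0) :
    ∀ (k : Fin K) (s : S),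
      (∑ a, π s a * Qk k (s, a)) ≤ (∑ a, π s a * QMP (s, a))
      ∧ (∑ a, π s a * QMP (s, a)) ≤ (∑ a, π s a * QP0 (s, a)) := by
  intro k s
  have weighted_mono : ∀ {Q Q' : S × A → ℝ}, (∀ x, Q x ≤ Q' x) →
      ∑ a, π s a * Q (s, a) ≤ ∑ a, π s a * Q' (s, a) := fun h =>
    Finset.sum_le_sum fun a _ => mul_le_mul_of_nonneg_left (h (s, a)) ((hπ s).1 a)
  constructor
  · refine weighted_mono (le_of_forall_le_add_imp_le_add_mul hγ1 fun M hM x => ?_)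
    have hop := robustOp_le_robustOp_add (r := r) hγ0 (fun s a => (hP k s a).1)
      (fun _ _ => subset_rfl) (fun s a => (hP k s a).2.2) hπ hM x
    rw [hQk k] at hop
    have hsup : robustOp r γ (P k) π QMP x ≤ QMP x := by
      conv_rhs => rw [← hQMP]
      exact Finset.le_sup' (fun k => robustOp r γ (P k) π QMP x) (Finset.mem_univ k)
    linarith
  · refine weighted_mono (le_of_forall_le_add_imp_le_add_mul hγ1 fun M hM x => ?_)
    conv_lhs => rw [← hQMP]
    refine Finset.sup'_le _ _ fun j _ => ?_
    have hop := robustOp_le_robustOp_add (r := r) (P' := fun s a => {P0 s a}) hγ0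
      (fun _ _ => Set.singleton_nonempty _) (fun s a => Set.singleton_subset_iff.2 (hP0 j s a))
      (fun s a => (hP j s a).2.2) hπ hM x
    rwa [hQP0] at hop
end
end

section
/- (Local iterate error bound for MDTL-Avg.) Assume λ ≤ 1/E and the heterogeneity bound |σ_{(𝒫_k)_s^a}(V_AO) − (1/K) Σ_{j=1}^K σ_{(𝒫_j)_s^a}(V_AO)| ≤ Γ/(1−γ) for all k, s, a, where V_AO(s) = max_a Q_AO(s,a). Then for every t ∈ {0,…,T−1} and every k ∈ {1,…,K}, the MDTL-Avg iterates satisfy ‖Q_AO − Q_k^t‖ ≤ ‖Q_AO − Q̄^{χ(t)}‖ + (3γ/(1−γ))·λ·(E−1)·Γ, where χ(t) = t − (t mod E). -/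
noncomputable section

theorem suppFn_le_add {S : Type*} [Fintype S] {C : Set (S → ℝ)} (hne : C.Nonempty)
    (hC : IsCompact C) (hsub : C ⊆ simplex S) {u v : S → ℝ} {c : ℝ}
    (h : ∀ s, u s ≤ v s + c) : suppFn C u ≤ suppFn C v + c := by
  rw [← sub_le_iff_le_add]
  refine le_csInf (hne.image _) ?_
  rintro _ ⟨p, hp, rfl⟩
  obtain ⟨hp0, hp1⟩ := hsub hp
  have hbdd : BddBelow ((fun p : S → ℝ => ∑ s, p s * u s) '' C) :=
    (hC.image (by fun_prop)).bddBelow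
  have hle : suppFn C u ≤ ∑ s, p s * u s := csInf_le hbdd ⟨p, hp, rfl⟩
  have hsum : ∑ s, p s * u s ≤ ∑ s, p s * (v s + c) :=
    Finset.sum_le_sum fun s _ => mul_le_mul_of_nonneg_left (h s) (hp0 s)
  have heq : ∑ s, p s * (v s + c) = ∑ s, p s * v s + c := by
    simp only [mul_add, Finset.sum_add_distrib, ← Finset.sum_mul, hp1, one_mul]
  simp only
  linarith

theorem abs_suppFn_sub_le {S : Type*} [Fintype S] {C : Set (S → ℝ)} (hne : C.Nonempty)
    (hC : IsCompact C) (hsub : C ⊆ simplex S) {u v : S → ℝ} {c : ℝ}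
    (h : ∀ s, |u s - v s| ≤ c) : |suppFn C u - suppFn C v| ≤ c := by
  have h₁ := suppFn_le_add hne hC hsub (u := u) (v := v) (c := c)
    fun s => by linarith [(abs_le.mp (h s)).2]
  have h₂ := suppFn_le_add hne hC hsub (u := v) (v := u) (c := c)
    fun s => by linarith [(abs_le.mp (h s)).1]
  exact abs_le.mpr ⟨by linarith, by linarith⟩

theorem Finset.abs_sup'_sub_sup'_le {ι : Type*} {s : Finset ι} (hs : s.Nonempty)
    {f g : ι → ℝ} {c : ℝ} (h : ∀ i ∈ s, |f i - g i| ≤ c) :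
    |s.sup' hs f - s.sup' hs g| ≤ c := by
  have h₁ : s.sup' hs f ≤ s.sup' hs g + c := Finset.sup'_le hs _ fun i hi => by
    linarith [(abs_le.mp (h i hi)).2, Finset.le_sup' g hi]
  have h₂ : s.sup' hs g ≤ s.sup' hs f + c := Finset.sup'_le hs _ fun i hi => by
    linarith [(abs_le.mp (h i hi)).1, Finset.le_sup' f hi]
  exact abs_le.mpr ⟨by linarith, by linarith⟩

/-- The optimal robust Bellman operator is a `γ`-contraction in the supremum norm. -/
theorem norm_optRobustOp_sub_le {S A : Type*} [Fintype S] [Fintype A] [Nonempty A]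
    (r : S × A → ℝ) {γ : ℝ} (hγ : 0 ≤ γ) {P : S → A → Set (S → ℝ)}
    (hP : ∀ s a, (P s a).Nonempty ∧ IsCompact (P s a) ∧ P s a ⊆ simplex S)
    (Q Q' : S × A → ℝ) :
    ‖optRobustOp r γ P Q - optRobustOp r γ P Q'‖ ≤ γ * ‖Q - Q'‖ := by
  refine (pi_norm_le_iff_of_nonneg (mul_nonneg hγ (norm_nonneg _))).mpr ?_
  rintro ⟨s, a⟩
  obtain ⟨hne, hC, hsub⟩ := hP s a
  simp only [optRobustOp, Pi.sub_apply, add_sub_add_left_eq_sub, ← mul_sub, norm_mul,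
    Real.norm_of_nonneg hγ]
  refine mul_le_mul_of_nonneg_left ?_ hγ
  exact abs_suppFn_sub_le hne hC hsub fun s' =>
    Finset.abs_sup'_sub_sup'_le _ fun a' _ => norm_le_pi_norm (Q - Q') (s', a')

/-- A fixed point of the averaged operator is moved by each individual operator by at most
`γ` times the heterogeneity of the support functions. -/
theorem norm_sub_optRobustOp_le {S A : Type*} [Fintype S] [Fintype A] [Nonempty A]
    (r : S × A → ℝ) {γ : ℝ} (hγ : 0 ≤ γ) {K : ℕ} [NeZero K]
    (P : Fin K → S → A → Set (S → ℝ)) {Q : S × A → ℝ}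
    (hQ : (fun sa => (K : ℝ)⁻¹ * ∑ k, optRobustOp r γ (P k) Q sa) = Q) {c : ℝ} (hc : 0 ≤ c)
    (k : Fin K)
    (hhet : ∀ s a,
      |suppFn (P k s a)
          (fun s' => Finset.univ.sup' Finset.univ_nonempty (fun a' => Q (s', a')))
        - (K : ℝ)⁻¹ * ∑ j, suppFn (P j s a)
          (fun s' => Finset.univ.sup' Finset.univ_nonempty (fun a' => Q (s', a')))| ≤ c) :
    ‖Q - optRobustOp r γ (P k) Q‖ ≤ γ * c := by
  refine (pi_norm_le_iff_of_nonneg (mul_nonneg hγ hc)).mpr ?_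
  rintro ⟨s, a⟩
  have hK : (K : ℝ) ≠ 0 := Nat.cast_ne_zero.mpr (NeZero.ne K)
  have hfix := congrFun hQ (s, a)
  simp only [optRobustOp, Finset.sum_add_distrib, Finset.sum_const, Finset.card_univ,
    Fintype.card_fin, nsmul_eq_mul, mul_add, inv_mul_cancel_left₀ hK, ← Finset.mul_sum,
    mul_left_comm _ γ] at hfix
  rw [Pi.sub_apply, ← hfix]
  simp only [optRobustOp, add_sub_add_left_eq_sub, ← mul_sub, norm_mul,
    Real.norm_of_nonneg hγ]
  refine mul_le_mul_of_nonneg_left ?_ hγ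
  rw [norm_sub_rev]
  exact hhet s a

/-- One relaxed step of a `γ`-contraction increases the distance to an almost fixed point `x`
by at most `lam * b`, where `b` bounds the displacement of `x`. -/
theorem norm_sub_relaxed_le {V : Type*} [NormedAddCommGroup V] [NormedSpace ℝ V]
    {F : V → V} {γ lam b : ℝ} (hγ1 : γ ≤ 1) (hlam0 : 0 ≤ lam) (hlam1 : lam ≤ 1) {x y : V}
    (hF : ‖F x - F y‖ ≤ γ * ‖x - y‖) (hb : ‖x - F x‖ ≤ b) :
    ‖x - ((1 - lam) • y + lam • F y)‖ ≤ ‖x - y‖ + lam * b := by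
  have hsplit : x - ((1 - lam) • y + lam • F y)
      = (1 - lam) • (x - y) + lam • ((x - F x) + (F x - F y)) := by
    module
  have h₁ : ‖(x - F x) + (F x - F y)‖ ≤ b + ‖x - y‖ :=
    norm_add_le_of_le hb (hF.trans (mul_le_of_le_one_left (norm_nonneg _) hγ1))
  calc ‖x - ((1 - lam) • y + lam • F y)‖
      ≤ (1 - lam) * ‖x - y‖ + lam * ‖(x - F x) + (F x - F y)‖ := by
        rw [hsplit]
        refine (norm_add_le _ _).trans_eq ?_
        rw [norm_smul, norm_smul, Real.norm_of_nonneg hlam0,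
          Real.norm_of_nonneg (sub_nonneg.mpr hlam1)]
    _ ≤ (1 - lam) * ‖x - y‖ + lam * (b + ‖x - y‖) := by gcongr
    _ = ‖x - y‖ + lam * b := by ring

/-- **Local iterate error bound for MDTL-Avg.**  If `λ ≤ 1/E` and the
heterogeneity bound holds, then each local iterate stays within
`(3γ/(1−γ))·λ·(E−1)·Γ` of the error of the last aggregated iterate
`Q̄^{χ(t)}`, where `χ(t) = t − (t mod E)`. -/
theorem mdtl_avg_local_error {S A : Type*} [Fintype S] [Fintype A]
    [Nonempty S] [Nonempty A]
    (r : S × A → ℝ) (hr : ∀ sa, 0 ≤ r sa ∧ r sa ≤ 1)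
    (γ : ℝ) (hγ0 : 0 ≤ γ) (hγ1 : γ < 1)
    (K : ℕ) [NeZero K]
    (P : Fin K → S → A → Set (S → ℝ))
    (hP : ∀ k s a, (P k s a).Nonempty ∧ IsCompact (P k s a) ∧ P k s a ⊆ simplex S)
    (QAO : S × A → ℝ)
    (hQAO : (fun sa => (K : ℝ)⁻¹ * ∑ k, optRobustOp r γ (P k) QAO sa) = QAO)
    (lam : ℝ) (hlam0 : 0 < lam) (hlam1 : lam ≤ 1)
    (E T : ℕ) (hE : 1 ≤ E)
    (hlamE : lam ≤ 1 / (E : ℝ))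
    (Γ : ℝ) (hΓ0 : 0 ≤ Γ)
    (hhet : ∀ k s a,
      |suppFn (P k s a)
          (fun s' => Finset.univ.sup' Finset.univ_nonempty (fun a' => QAO (s', a')))
        - (K : ℝ)⁻¹ * ∑ j, suppFn (P j s a)
          (fun s' => Finset.univ.sup' Finset.univ_nonempty (fun a' => QAO (s', a')))|
        ≤ Γ / (1 - γ))
    (Q0 : S × A → ℝ) (hQ0 : ∀ sa, 0 ≤ Q0 sa ∧ Q0 sa ≤ 1 / (1 - γ))
    (Qk : ℕ → Fin K → (S × A → ℝ))
    (hinit : ∀ k, Qk 0 k = Q0)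
    (hstep : ∀ t k, Qk (t + 1) k =
      if (t + 1) % E = 0 then
        (K : ℝ)⁻¹ • ∑ j, ((1 - lam) • Qk t j + lam • optRobustOp r γ (P j) (Qk t j))
      else (1 - lam) • Qk t k + lam • optRobustOp r γ (P k) (Qk t k)) :
    ∀ t < T, ∀ k,
      ‖QAO - Qk t k‖ ≤
        ‖QAO - (K : ℝ)⁻¹ • ∑ j, Qk (t - t % E) j‖
          + 3 * γ / (1 - γ) * lam * ((E : ℝ) - 1) * Γ := by
  have h1γ : 0 < 1 - γ := sub_pos.mpr hγ1
  have hK : (K : ℝ) ≠ 0 := Nat.cast_ne_zero.mpr (NeZero.ne K)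
  have hsync : ∀ t, t % E = 0 → ∀ k, Qk t k = (K : ℝ)⁻¹ • ∑ j, Qk t j := by
    intro t ht k
    have hconst : ∀ j, Qk t j = Qk t k := by
      intro j
      cases t with
      | zero => rw [hinit, hinit]
      | succ t => rw [hstep, hstep, if_pos ht, if_pos ht]
    simp only [hconst, Finset.sum_const, Finset.card_univ, Fintype.card_fin]
    rw [← Nat.cast_smul_eq_nsmul ℝ, inv_smul_smul₀ hK]
  have hdrift : ∀ t k, ‖QAO - Qk t k‖ ≤
      ‖QAO - (K : ℝ)⁻¹ • ∑ j, Qk (t - t % E) j‖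
        + ((t % E : ℕ) : ℝ) * (lam * (γ * (Γ / (1 - γ)))) := by
    intro t k
    induction t with
    | zero => simp [← hsync 0 (Nat.zero_mod E) k]
    | succ t ih =>
      by_cases ht : (t + 1) % E = 0
      · simp [ht, ← hsync (t + 1) ht k]
      · have hmod : (t + 1) % E = t % E + 1 := by
          rw [Nat.add_mod_eq_ite] at ht ⊢
          have := Nat.mod_lt t hE
          rcases hE.lt_or_eq with h | h
          · rw [Nat.mod_eq_of_lt h] at ht ⊢
            split_ifs at ht ⊢ <;> omega
          · subst h
            simp [Nat.mod_one] at ht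
        rw [hmod, Nat.add_sub_add_right, hstep, if_neg ht]
        have hone := norm_sub_relaxed_le hγ1.le hlam0.le hlam1
          (norm_optRobustOp_sub_le r hγ0 (hP k) QAO (Qk t k))
          (norm_sub_optRobustOp_le r hγ0 P hQAO (div_nonneg hΓ0 h1γ.le) k (hhet k))
        push_cast
        linarith
  intro t _ k
  refine (hdrift t k).trans (add_le_add_right ?_ _)
  have hmE : ((t % E : ℕ) : ℝ) ≤ (E : ℝ) - 1 := by
    have : t % E + 1 ≤ E := Nat.mod_lt t hE
    rw [le_sub_iff_add_le]
    exact_mod_cast this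
  have hc : 0 ≤ lam * (γ * (Γ / (1 - γ))) := by positivity
  have hE1 : 0 ≤ (E : ℝ) - 1 := (Nat.cast_nonneg _).trans hmE
  calc ((t % E : ℕ) : ℝ) * (lam * (γ * (Γ / (1 - γ))))
      ≤ ((E : ℝ) - 1) * (lam * (γ * (Γ / (1 - γ)))) := by gcongr
    _ ≤ 3 * (((E : ℝ) - 1) * (lam * (γ * (Γ / (1 - γ))))) :=
        le_mul_of_one_le_left (mul_nonneg hE1 hc) (by norm_num)
    _ = 3 * γ / (1 - γ) * lam * ((E : ℝ) - 1) * Γ := by ring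
end
end
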